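/- Let X be a complex m×n matrix. Then ‖X‖_F² = ‖X*X‖_B, where X* is the conjugate transpose of X. -/

import Mathlib

open Matrix
open scoped ComplexOrder

noncomputable section

namespace MatFact

/-- ℓ² norm of a complex vector. -/
def vnorm {n : ℕ} (v : Fin n → ℂ) : ℝ := Real.sqrt (∑ j, ‖v j‖ ^ 2)

/-- Operator norm of a matrix as a map ℓ²(Fin n) → ℓ²(Fin m). -/
def opNorm {m n : ℕ} (X : Matrix (Fin m) (Fin n) ℂ) : ℝ :=
  sSup {c : ℝ | ∃ v : Fin n → ℂ, vnorm v ≤ 1 ∧ c = vnorm (X.mulVec v)}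

/-- Column norm: the maximal ℓ² norm of a column. -/
def colNorm {m n : ℕ} (X : Matrix (Fin m) (Fin n) ℂ) : ℝ :=
  ⨆ j : Fin n, vnorm (fun i => X i j)

/-- Hilbert–Schmidt (Frobenius) norm. -/
def frobNorm {m n : ℕ} (X : Matrix (Fin m) (Fin n) ℂ) : ℝ :=
  Real.sqrt (∑ i, ∑ j, ‖X i j‖ ^ 2)

/-- Schur norm: operator norm of Schur (entrywise) multiplication by `X`
on matrices with the operator norm. -/
def schurNorm {m n : ℕ} (X : Matrix (Fin m) (Fin n) ℂ) : ℝ :=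
  sSup {c : ℝ | ∃ A : Matrix (Fin m) (Fin n) ℂ, opNorm A ≤ 1 ∧
    c = opNorm (Matrix.hadamard X A)}

/-- The T-norm (bilinear Schur norm). -/
def Tnorm {m n : ℕ} (X : Matrix (Fin m) (Fin n) ℂ) : ℝ :=
  sSup {c : ℝ | ∃ (a : Fin m → ℂ) (B : Matrix (Fin m) (Fin n) ℂ),
    (∀ i, ‖a i‖ ≤ 1) ∧ opNorm B ≤ 1 ∧
    c = vnorm (fun j => ∑ i, a i * X i j * B i j)}

/-- The F-norm: operator norm of `X` from `ℂⁿ` with the sup norm to `ℂᵐ`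
with the ℓ² norm. -/
def Fnorm {m n : ℕ} (X : Matrix (Fin m) (Fin n) ℂ) : ℝ :=
  sSup {c : ℝ | ∃ v : Fin n → ℂ, (∀ j, ‖v j‖ ≤ 1) ∧ c = vnorm (X.mulVec v)}

/-- The bilinear form norm. -/
def Bnorm {m n : ℕ} (Y : Matrix (Fin m) (Fin n) ℂ) : ℝ :=
  sSup {c : ℝ | ∃ (a : Fin m → ℂ) (b : Fin n → ℂ), (∀ i, ‖a i‖ ≤ 1) ∧
    (∀ j, ‖b j‖ ≤ 1) ∧ c = ‖∑ i, ∑ j, Y i j * a i * b j‖}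

/-- The completely bounded F-norm. -/
def cbF {m n : ℕ} (X : Matrix (Fin m) (Fin n) ℂ) : ℝ :=
  sInf {c : ℝ | ∃ (A : Matrix (Fin m) (Fin n) ℂ) (ξ : Fin n → ℂ),
    X = A * Matrix.diagonal ξ ∧ c = opNorm A * vnorm ξ}

/-- The completely bounded bilinear form norm. -/
def cbB {m n : ℕ} (X : Matrix (Fin m) (Fin n) ℂ) : ℝ :=
  sInf {c : ℝ | ∃ (η : Fin m → ℂ) (B : Matrix (Fin m) (Fin n) ℂ) (ξ : Fin n → ℂ),
    X = Matrix.diagonal η * B * Matrix.diagonal ξ ∧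
    c = vnorm η * opNorm B * vnorm ξ}

/-- The range (column space) of a matrix, as a submodule of `ℂᵐ`. -/
def ran {m n : ℕ} (X : Matrix (Fin m) (Fin n) ℂ) : Submodule ℂ (Fin m → ℂ) :=
  LinearMap.range X.mulVecLin

/-- `P` is the orthogonal projection onto the subspace `E`, i.e. `P` is a
Hermitian idempotent with range `E`. -/
def IsOrthProjOnto {n : ℕ} (P : Matrix (Fin n) (Fin n) ℂ)
    (E : Submodule ℂ (Fin n → ℂ)) : Prop :=
  P.IsHermitian ∧ P * P = P ∧ ran P = E

/-- `W` is a partial isometry with support `E` and range `F`. -/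
def IsPartialIsometryFromTo {m n : ℕ} (W : Matrix (Fin m) (Fin n) ℂ)
    (E : Submodule ℂ (Fin n → ℂ)) (F : Submodule ℂ (Fin m → ℂ)) : Prop :=
  IsOrthProjOnto (Wᴴ * W) E ∧ IsOrthProjOnto (W * Wᴴ) F

/-- A cb operator factorization of `X`. -/
def IsCbOpFact {m n : ℕ} (X A : Matrix (Fin m) (Fin n) ℂ) (ξ : Fin n → ℂ) : Prop :=
  (∀ j, 0 ≤ ξ j) ∧ vnorm ξ = 1 ∧ opNorm A = cbF X ∧
  (∀ j, ξ j = 0 → ∀ i, A i j = 0) ∧ X = A * Matrix.diagonal ξ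

/-- A cb bilinear form factorization of `X`. -/
def IsCbBilFact {m n : ℕ} (X : Matrix (Fin m) (Fin n) ℂ) (η : Fin m → ℂ)
    (B : Matrix (Fin m) (Fin n) ℂ) (ξ : Fin n → ℂ) : Prop :=
  (∀ i, 0 ≤ η i) ∧ (∀ j, 0 ≤ ξ j) ∧ vnorm η = 1 ∧ vnorm ξ = 1 ∧
  opNorm B = cbB X ∧ (∀ j, ξ j = 0 → ∀ i, B i j = 0) ∧
  (∀ i, η i = 0 → ∀ j, B i j = 0) ∧ X = Matrix.diagonal η * B * Matrix.diagonal ξ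

/-- A Schur factorization of `X`. -/
def IsSchurFact {m n : ℕ} (X : Matrix (Fin m) (Fin n) ℂ)
    (F : Matrix (Fin m) (Fin m) ℂ) (W : Matrix (Fin m) (Fin n) ℂ)
    (G : Matrix (Fin n) (Fin n) ℂ) : Prop :=
  F.PosSemidef ∧ (∀ i, (F * F) i i ≤ 1) ∧ G.PosSemidef ∧ (∀ j, (G * G) j j ≤ 1) ∧
  IsPartialIsometryFromTo W (ran G) (ran F) ∧
  X = (schurNorm X : ℂ) • (F * W * G)

/-- A bilinear Schur factorization of `X`. -/
def IsBilinSchurFact {m n : ℕ} (X : Matrix (Fin m) (Fin n) ℂ)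
    (T : Matrix (Fin m) (Fin m) ℂ) (W : Matrix (Fin m) (Fin n) ℂ)
    (G : Matrix (Fin n) (Fin n) ℂ) : Prop :=
  T.PosSemidef ∧ frobNorm T = Tnorm X ∧ G.PosSemidef ∧ (∀ j, (G * G) j j ≤ 1) ∧
  IsPartialIsometryFromTo W (ran G) (ran T) ∧ X = T * W * G

/-- Maximal diagonal entry (real part) of a square matrix. -/
def maxDiag {n : ℕ} (P : Matrix (Fin n) (Fin n) ℂ) : ℝ := ⨆ i, (P i i).re

end MatFact

namespace MatFact

lemma vnorm_nonneg {n : ℕ} (v : Fin n → ℂ) : 0 ≤ vnorm v := Real.sqrt_nonneg _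

lemma sq_vnorm {n : ℕ} (v : Fin n → ℂ) : vnorm v ^ 2 = ∑ j, ‖v j‖ ^ 2 :=
  Real.sq_sqrt (Finset.sum_nonneg fun _ _ => sq_nonneg _)

/-- The set whose supremum is `Fnorm X` is bounded above. -/
lemma bddAbove_Fnorm {m n : ℕ} (X : Matrix (Fin m) (Fin n) ℂ) :
    BddAbove {c : ℝ | ∃ v : Fin n → ℂ, (∀ j, ‖v j‖ ≤ 1) ∧ c = vnorm (X.mulVec v)} := by
  refine ⟨Real.sqrt (∑ i, (∑ j, ‖X i j‖) ^ 2), ?_⟩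
  rintro _ ⟨v, hv, rfl⟩
  refine Real.sqrt_le_sqrt (Finset.sum_le_sum fun i _ => ?_)
  gcongr
  refine (norm_sum_le Finset.univ fun j => X i j * v j).trans (Finset.sum_le_sum fun j _ => ?_)
  rw [norm_mul]
  exact mul_le_of_le_one_right (norm_nonneg _) (hv j)

lemma vnorm_mulVec_le_Fnorm {m n : ℕ} (X : Matrix (Fin m) (Fin n) ℂ) {v : Fin n → ℂ}
    (hv : ∀ j, ‖v j‖ ≤ 1) : vnorm (X.mulVec v) ≤ Fnorm X :=
  le_csSup (bddAbove_Fnorm X) ⟨v, hv, rfl⟩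

lemma Fnorm_nonneg {m n : ℕ} (X : Matrix (Fin m) (Fin n) ℂ) : 0 ≤ Fnorm X :=
  (vnorm_nonneg _).trans (vnorm_mulVec_le_Fnorm X (v := 0) (by simp))

/-- The Cauchy–Schwarz inequality. -/
lemma norm_star_dotProduct_le {n : ℕ} (u v : Fin n → ℂ) :
    ‖star u ⬝ᵥ v‖ ≤ vnorm u * vnorm v := by
  refine (norm_sum_le Finset.univ fun j => star u j * v j).trans ?_
  simp only [norm_mul, Pi.star_apply, norm_star]
  exact Real.sum_mul_le_sqrt_mul_sqrt _ _ _

lemma norm_star_dotProduct_self {n : ℕ} (v : Fin n → ℂ) : ‖star v ⬝ᵥ v‖ = vnorm v ^ 2 := by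
  have h : star v ⬝ᵥ v = ((∑ j, ‖v j‖ ^ 2 : ℝ) : ℂ) := by
    simp [dotProduct, Complex.conj_mul']
  rw [h, sq_vnorm, Complex.norm_real, Real.norm_of_nonneg]
  exact Finset.sum_nonneg fun _ _ => sq_nonneg _

/-- The bilinear form of `Xᴴ * X` is an inner product of images under `X`. -/
lemma sum_conjTranspose_mul_self {m n : ℕ} (X : Matrix (Fin m) (Fin n) ℂ) (a b : Fin n → ℂ) :
    ∑ i, ∑ j, (Xᴴ * X) i j * a i * b j = star (X *ᵥ star a) ⬝ᵥ (X *ᵥ b) := by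
  rw [star_mulVec, star_star, ← dotProduct_mulVec, mulVec_mulVec]
  simp only [dotProduct, mulVec, Finset.mul_sum]
  exact Finset.sum_congr rfl fun i _ => Finset.sum_congr rfl fun j _ => by ring

theorem stmt16 {m n : ℕ} (X : Matrix (Fin m) (Fin n) ℂ) :
    Fnorm X ^ 2 = Bnorm (Xᴴ * X) := by
  have bound : ∀ c ∈ {c : ℝ | ∃ (a : Fin n → ℂ) (b : Fin n → ℂ), (∀ i, ‖a i‖ ≤ 1) ∧
      (∀ j, ‖b j‖ ≤ 1) ∧ c = ‖∑ i, ∑ j, (Xᴴ * X) i j * a i * b j‖}, c ≤ Fnorm X ^ 2 := by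
    rintro _ ⟨a, b, ha, hb, rfl⟩
    rw [sum_conjTranspose_mul_self, sq]
    exact (norm_star_dotProduct_le _ _).trans <| mul_le_mul
      (vnorm_mulVec_le_Fnorm X fun j => by simpa using ha j) (vnorm_mulVec_le_Fnorm X hb)
      (vnorm_nonneg _) (Fnorm_nonneg X)
  apply le_antisymm
  · have le_sqrt : Fnorm X ≤ Real.sqrt (Bnorm (Xᴴ * X)) := by
      refine csSup_le ⟨_, 0, by simp, rfl⟩ ?_
      rintro _ ⟨v, hv, rfl⟩
      refine Real.le_sqrt_of_sq_le (le_csSup ⟨_, bound⟩ ⟨star v, v, by simpa using hv, hv, ?_⟩)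
      rw [sum_conjTranspose_mul_self, star_star, norm_star_dotProduct_self]
    refine (Real.le_sqrt (Fnorm_nonneg X) ?_).1 le_sqrt
    exact Real.sSup_nonneg (by rintro _ ⟨a, b, -, -, rfl⟩; exact norm_nonneg _)
  · exact csSup_le ⟨_, 0, 0, by simp, by simp, rfl⟩ bound

end MatFact
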